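/- Define A_n as the number of North/East Dyck paths from (0,0) to (5n−1, 2n−1) staying weakly below y=(2/5)x+1/5, and B_n as those staying weakly below y=(2/5)x. Then A_n + B_n = (2/(7n−1))·C(7n−1, 2n) for all n ≥ 1. -/

import Mathlib

/-- `knuthA n` = number of North/East lattice paths from `(0,0)` to `(5n−1, 2n−1)`
staying weakly below `y = (2/5)x + 1/5`, i.e. `5y ≤ 2x + 1` at every vertex. -/
noncomputable def knuthA (n : ℕ) : ℕ :=
  Nat.card {l : List (ℕ × ℕ) //
    (∀ s ∈ l, s = (1, 0) ∨ s = (0, 1)) ∧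
    l.sum = (5 * n - 1, 2 * n - 1) ∧
    ∀ k ≤ l.length, 5 * ((l.take k).sum).2 ≤ 2 * ((l.take k).sum).1 + 1}

/-- `knuthB n` = number of North/East lattice paths from `(0,0)` to `(5n−1, 2n−1)`
staying weakly below `y = (2/5)x`, i.e. `5y ≤ 2x` at every vertex. -/
noncomputable def knuthB (n : ℕ) : ℕ :=
  Nat.card {l : List (ℕ × ℕ) //
    (∀ s ∈ l, s = (1, 0) ∨ s = (0, 1)) ∧
    l.sum = (5 * n - 1, 2 * n - 1) ∧
    ∀ k ≤ l.length, 5 * ((l.take k).sum).2 ≤ 2 * ((l.take k).sum).1}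

namespace KnuthAB

open Finset

/-- weight of the `j`-th step of the periodic word coded by `S`. -/
def wt {L : ℕ} (S : Finset (ZMod L)) (j : ℕ) : ℤ := if (j : ZMod L) ∈ S then -5 else 2

/-- height after `k` steps. -/
def ht {L : ℕ} (S : Finset (ZMod L)) (k : ℕ) : ℤ := ∑ j ∈ range k, wt S j

/-- the step itself. -/
def stp {L : ℕ} (S : Finset (ZMod L)) (j : ℕ) : ℕ × ℕ := if (j : ZMod L) ∈ S then (0, 1) else (1, 0)

lemma core (L : ℕ) (hL : 0 < L) (H : ℕ → ℤ) (hH : ∀ k, H (k + L) = H k - 2) :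
    ∑ i ∈ range L, ((if ∀ k < L, -1 ≤ H (i + k) - H i then (1 : ℤ) else 0)
      + (if ∀ k < L, 0 ≤ H (i + k) - H i then (1 : ℤ) else 0)) = 2 := by
  have hne : (range L).Nonempty := ⟨0, by simpa using hL⟩
  let m : ℕ → ℤ := fun i => (range L).inf' hne (fun k => H (i + k))
  have hle : ∀ i c, c ≤ m i ↔ ∀ k < L, c ≤ H (i + k) := by
    intro i c; simp [m, Finset.le_inf'_iff]
  have hmi : ∀ i, m i ≤ H i := fun i => by
    have := (hle i (m i)).1 le_rfl 0 hL
    simpa using this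
  have hstep : ∀ i, m (i + 1) = min (m i) (H i - 2) := by
    intro i
    apply eq_of_forall_le_iff
    intro c
    rw [le_min_iff, hle, hle]
    constructor
    · intro h
      have h1 : c ≤ H i - 2 := by
        have := h (L - 1) (by omega)
        rwa [show i + 1 + (L - 1) = i + L by omega, hH] at this
      refine ⟨fun k hk => ?_, h1⟩
      rcases k with _ | k
      · simp; linarith
      · have := h k (by omega)
        rwa [show i + 1 + k = i + (k + 1) by omega] at this
    · rintro ⟨h, h1⟩ k hk
      by_cases hk' : k + 1 < L
      · have := h (k + 1) hk'
        rwa [show i + (k + 1) = i + 1 + k by omega] at this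
      · rw [show i + 1 + k = i + L by omega, hH]; exact h1
  have hterm : ∀ i, ((if ∀ k < L, -1 ≤ H (i + k) - H i then (1 : ℤ) else 0)
      + (if ∀ k < L, 0 ≤ H (i + k) - H i then (1 : ℤ) else 0)) = m i - m (i + 1) := by
    intro i
    have e1 : (∀ k < L, -1 ≤ H (i + k) - H i) ↔ H i - 1 ≤ m i := by
      rw [hle]; exact forall₂_congr fun k _ => by constructor <;> intro h <;> linarith
    have e2 : (∀ k < L, 0 ≤ H (i + k) - H i) ↔ H i ≤ m i := by
      rw [hle]; exact forall₂_congr fun k _ => by constructor <;> intro h <;> linarith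
    simp only [e1, e2, hstep]
    have := hmi i
    split_ifs <;> omega
  rw [sum_congr rfl fun i _ => hterm i, Finset.sum_range_sub']
  have : m L = m 0 - 2 := by
    apply eq_of_forall_le_iff
    intro c
    rw [le_sub_iff_add_le, hle, hle]
    refine forall₂_congr fun k _ => ?_
    rw [Nat.add_comm L k, hH, Nat.zero_add]
    constructor <;> intro h <;> linarith
  rw [this]; ring

variable {L : ℕ}

lemma ht_L [NeZero L] (S : Finset (ZMod L)) : ht S L = 2 * L - 7 * (#S : ℤ) := by
  have h : ht S L = ∑ z : ZMod L, (if z ∈ S then (-5 : ℤ) else 2) := by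
    unfold ht wt
    refine Finset.sum_nbij' (fun j => (j : ZMod L)) ZMod.val ?_ ?_ ?_ ?_ ?_
    · simp
    · intro z _; simpa using ZMod.val_lt z
    · intro j hj; exact ZMod.val_cast_of_lt (by simpa using hj)
    · intro z _; simp
    · simp
  have h2 : ∀ z : ZMod L, (if z ∈ S then (-5 : ℤ) else 2) = 2 - 7 * (if z ∈ S then 1 else 0) := by
    intro z; split_ifs <;> norm_num
  rw [h, sum_congr rfl fun z _ => h2 z, Finset.sum_sub_distrib, ← Finset.mul_sum]
  simp [ZMod.card, mul_comm]

lemma ht_add (S : Finset (ZMod L)) (a k : ℕ) :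
    ht S (a + k) = ht S a + ∑ j ∈ range k, wt S (a + j) := by
  unfold ht; rw [Finset.sum_range_add]

lemma ht_period (S : Finset (ZMod L)) (k : ℕ) : ht S (k + L) = ht S k + ht S L := by
  rw [Nat.add_comm, ht_add, add_comm]
  congr 1
  refine sum_congr rfl fun j _ => ?_
  simp [wt]

/-- translation of words. -/
def shift (i : ℕ) : Finset (ZMod L) ≃ Finset (ZMod L) := (Equiv.subRight (i : ZMod L)).finsetCongr

lemma card_shift (i : ℕ) (S : Finset (ZMod L)) : #(shift i S) = #S := by
  simp [shift]

lemma wt_shift (i : ℕ) (S : Finset (ZMod L)) (j : ℕ) : wt (shift i S) j = wt S (i + j) := by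
  have : (j : ZMod L) ∈ shift i S ↔ ((i + j : ℕ) : ZMod L) ∈ S := by
    simp only [shift, Equiv.finsetCongr_apply, Finset.mem_map, Equiv.coe_toEmbedding,
      Equiv.subRight_apply, Nat.cast_add]
    constructor
    · rintro ⟨a, ha, h⟩
      rw [← h]; simpa using ha
    · intro h
      exact ⟨_, h, by ring⟩
  simp [wt, this]

lemma ht_shift (i : ℕ) (S : Finset (ZMod L)) (k : ℕ) :
    ht (shift i S) k = ht S (i + k) - ht S i := by
  rw [ht_add]; simp [ht, wt_shift]

/-- number of words of type `c`. -/
def cnt (L : ℕ) [NeZero L] (n c : ℕ) : ℕ :=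
  #{S ∈ powersetCard (2 * n) (univ : Finset (ZMod L)) | ∀ k < L, -(c : ℤ) ≤ ht S k}

lemma cnt_shift [NeZero L] (n c i : ℕ) :
    ∑ S ∈ powersetCard (2 * n) (univ : Finset (ZMod L)),
      (if ∀ k < L, -(c : ℤ) ≤ ht S (i + k) - ht S i then (1 : ℤ) else 0) = cnt L n c := by
  unfold cnt
  rw [Finset.card_filter]
  push_cast
  refine Finset.sum_equiv (shift i) ?_ ?_
  · intro S; simp [mem_powersetCard, card_shift]
  · intro S _; simp only [ht_shift]

lemma count [NeZero L] (n : ℕ) (hL : L + 1 = 7 * n) :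
    (cnt L n 1 + cnt L n 0) * L = 2 * L.choose (2 * n) := by
  have h0 : 0 < L := Nat.pos_of_ne_zero (NeZero.ne L)
  have h1 : ∑ S ∈ powersetCard (2 * n) (univ : Finset (ZMod L)), ∑ i ∈ range L,
      ((if ∀ k < L, -1 ≤ ht S (i + k) - ht S i then (1 : ℤ) else 0)
      + (if ∀ k < L, 0 ≤ ht S (i + k) - ht S i then (1 : ℤ) else 0))
      = ∑ S ∈ powersetCard (2 * n) (univ : Finset (ZMod L)), 2 := by
    refine sum_congr rfl fun S hS => core L h0 (ht S) fun k => ?_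
    rw [ht_period, ht_L, (mem_powersetCard.1 hS).2]
    push_cast
    omega
  rw [Finset.sum_comm] at h1
  have h2 : ∀ i, ∑ S ∈ powersetCard (2 * n) (univ : Finset (ZMod L)),
      ((if ∀ k < L, -1 ≤ ht S (i + k) - ht S i then (1 : ℤ) else 0)
      + (if ∀ k < L, 0 ≤ ht S (i + k) - ht S i then (1 : ℤ) else 0))
      = cnt L n 1 + cnt L n 0 := by
    intro i
    rw [Finset.sum_add_distrib, ← cnt_shift n 1 i, ← cnt_shift n 0 i]
    simp
  rw [sum_congr rfl fun i _ => h2 i] at h1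
  simp only [sum_const, card_range, card_powersetCard, card_univ, ZMod.card, nsmul_eq_mul] at h1
  have h3 : (((cnt L n 1 + cnt L n 0) * L : ℕ) : ℤ) = ((2 * L.choose (2 * n) : ℕ) : ℤ) := by
    push_cast; linarith
  exact_mod_cast h3

lemma sum_stp (S : Finset (ZMod L)) (k : ℕ) :
    2 * ((((List.range k).map (stp S)).sum).1 : ℤ) - 5 * (((List.range k).map (stp S)).sum).2 = ht S k
    ∧ (((List.range k).map (stp S)).sum).1 + (((List.range k).map (stp S)).sum).2 = k := by
  induction k with
  | zero => simp [ht]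
  | succ k ih =>
    have e : ht S (k + 1) = ht S k + wt S k := by simp [ht, sum_range_succ]
    rw [List.range_succ, List.map_append, List.sum_append, e]
    simp only [List.map_cons, List.map_nil, List.sum_cons, List.sum_nil, Prod.fst_add,
      Prod.snd_add, add_zero]
    unfold stp wt at *
    split_ifs <;> push_cast <;> omega

lemma length_eq (l : List (ℕ × ℕ)) (h : ∀ s ∈ l, s = (1, 0) ∨ s = (0, 1)) :
    l.sum.1 + l.sum.2 = l.length := by
  induction l with
  | nil => simp
  | cons a l ih =>
    have := ih fun s hs => h s (by simp [hs])
    have ha := h a (by simp)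
    simp only [List.sum_cons, Prod.fst_add, Prod.snd_add, List.length_cons]
    rcases ha with rfl | rfl <;> simp <;> omega

lemma ht_succ (S : Finset (ZMod L)) (k : ℕ) : ht S (k + 1) = ht S k + wt S k := by
  simp [ht, sum_range_succ]

lemma last_mem [NeZero L] (n c : ℕ) (hc : c ≤ 1) (hL : L + 1 = 7 * n) (S : Finset (ZMod L))
    (hS : #S = 2 * n) (h : ∀ k < L, -(c : ℤ) ≤ ht S k) :
    ((L - 1 : ℕ) : ZMod L) ∈ S ∧ ht S (L - 1) = 3 := by
  have h0 : 0 < L := Nat.pos_of_ne_zero (NeZero.ne L)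
  have h1 := ht_L S
  have h2 := ht_succ S (L - 1)
  have h3 := h (L - 1) (by omega)
  rw [Nat.sub_add_cancel h0, h1, hS] at h2
  unfold wt at h2
  split_ifs at h2 with h4
  · refine ⟨h4, ?_⟩
    push_cast at h2; omega
  · push_cast at h2; omega

lemma card_lists [NeZero L] (n c : ℕ) (hc : c ≤ 1) (hL : L + 1 = 7 * n) :
    Nat.card {l : List (ℕ × ℕ) //
    (∀ s ∈ l, s = (1, 0) ∨ s = (0, 1)) ∧
    l.sum = (5 * n - 1, 2 * n - 1) ∧
    ∀ k ≤ l.length, 5 * ((l.take k).sum).2 ≤ 2 * ((l.take k).sum).1 + c} = cnt L n c := by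
  have h0 : 0 < L := Nat.pos_of_ne_zero (NeZero.ne L)
  unfold cnt
  rw [← Nat.card_eq_finsetCard]
  symm
  let F : {S // S ∈ ({S ∈ powersetCard (2 * n) (univ : Finset (ZMod L)) |
      ∀ k < L, -(c : ℤ) ≤ ht S k} : Finset (Finset (ZMod L)))} → {l : List (ℕ × ℕ) //
    (∀ s ∈ l, s = (1, 0) ∨ s = (0, 1)) ∧
    l.sum = (5 * n - 1, 2 * n - 1) ∧
    ∀ k ≤ l.length, 5 * ((l.take k).sum).2 ≤ 2 * ((l.take k).sum).1 + c} := fun S =>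
    ⟨(List.range (L - 1)).map (stp S.1), by
      obtain ⟨S, hS⟩ := S
      simp only [mem_filter, mem_powersetCard, subset_univ, true_and] at hS
      obtain ⟨hS, h⟩ := hS
      obtain ⟨_, h3⟩ := last_mem n c hc hL S hS h
      refine ⟨?_, ?_, ?_⟩
      · intro s hs
        obtain ⟨j, _, rfl⟩ := List.mem_map.1 hs
        unfold stp
        split_ifs <;> simp
      · have := sum_stp S (L - 1)
        rw [h3] at this
        apply Prod.ext <;> simp only <;> omega
      · intro k hk
        simp only [List.length_map, List.length_range] at hk
        rw [← List.map_take, List.take_range, min_eq_left hk]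
        have := sum_stp S k
        have := h k (by omega)
        simp only
        omega⟩
  refine Nat.card_eq_of_bijective F ⟨?_, ?_⟩
  · rintro ⟨S, hS⟩ ⟨T, hT⟩ hST
    have hST' : (List.range (L - 1)).map (stp S) = (List.range (L - 1)).map (stp T) :=
      congrArg Subtype.val hST
    simp only [mem_filter, mem_powersetCard, subset_univ, true_and] at hS hT
    have mS := (last_mem n c hc hL S hS.1 hS.2).1
    have mT := (last_mem n c hc hL T hT.1 hT.2).1
    apply Subtype.ext
    ext z
    show z ∈ S ↔ z ∈ T
    have hz := ZMod.val_lt z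
    rw [← ZMod.natCast_zmod_val z]
    by_cases hlast : z.val = L - 1
    · rw [hlast]; exact ⟨fun _ => mT, fun _ => mS⟩
    · have := List.map_inj_left.1 hST' z.val (by simp; omega)
      unfold stp at this
      split_ifs at this with a b b
      · exact ⟨fun _ => b, fun _ => a⟩
      · simp at this
      · simp at this
      · exact ⟨fun h => absurd h a, fun h => absurd h b⟩
  · rintro ⟨l, hl, hsum, hk⟩
    have hlen := length_eq l hl
    rw [hsum] at hlen
    simp only at hlen
    have hlen' : l.length = L - 1 := by omega
    let S : Finset (ZMod L) := {z | z.val = L - 1 ∨ l[z.val]? = some (0, 1)}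
    have hmem : ∀ j < L, ((j : ZMod L) ∈ S ↔ (j = L - 1 ∨ l[j]? = some (0, 1))) := by
      intro j hj
      simp [S, ZMod.val_cast_of_lt hj]
    have hF : (List.range (L - 1)).map (stp S) = l := by
      apply List.ext_getElem
      · simp [hlen']
      · intro j h1 h2
        have hj : j < L - 1 := by omega
        have hm := hmem j (by omega)
        rw [List.getElem?_eq_getElem h2, Option.some_inj] at hm
        simp only [List.getElem_map, List.getElem_range, stp]
        rcases hl l[j] (List.getElem_mem h2) with h | h
        · rw [if_neg, h]
          rw [hm, h]; simp; omega
        · rw [if_pos, h]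
          rw [hm]; exact Or.inr h
    have hht : ∀ k ≤ L - 1, -(c : ℤ) ≤ ht S k := by
      intro k hk'
      have h1 := hk k (by omega)
      rw [← hF, ← List.map_take, List.take_range, min_eq_left hk'] at h1
      have := sum_stp S k
      omega
    have hcard : #S = 2 * n := by
      have h1 := sum_stp S (L - 1)
      rw [hF, hsum] at h1
      have h2 := ht_succ S (L - 1)
      rw [Nat.sub_add_cancel h0, ht_L, ← h1.1, wt, if_pos ((hmem (L - 1) (by omega)).2 (Or.inl rfl))] at h2
      simp only at h2
      omega
    refine ⟨⟨S, ?_⟩, Subtype.ext hF⟩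
    simp only [mem_filter, mem_powersetCard, subset_univ, true_and]
    exact ⟨hcard, fun k hk => hht k (by omega)⟩

end KnuthAB

theorem knuth_A_plus_B (n : ℕ) (hn : 1 ≤ n) :
    (knuthA n + knuthB n) * (7 * n - 1) = 2 * (7 * n - 1).choose (2 * n) := by
  haveI : NeZero (7 * n - 1) := ⟨by omega⟩
  have hA : knuthA n = KnuthAB.cnt (7 * n - 1) n 1 :=
    KnuthAB.card_lists n 1 le_rfl (by omega)
  have hB : knuthB n = KnuthAB.cnt (7 * n - 1) n 0 :=
    KnuthAB.card_lists n 0 (by omega) (by omega)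
  rw [hA, hB]
  exact KnuthAB.count n (by omega)
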